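/- Let (U,W) be a split of G, let b^U and b^W be capacity functions with b^U_v ≤ b(v) for every v ∈ U and b^W_v ≤ b(v) for every v ∈ W (with arbitrary capacities at the split marker vertices w and u), and let x^U and x^W be b-matchings of (G_U, b^U) and (G_W, b^W) respectively with deg_{x^U}(w) = deg_{x^W}(u) = d. Then there exists a b-matching x of (G,b) such that ‖x‖₁ = ‖x^U‖₁ + ‖x^W‖₁ − d. -/

import Mathlib

open scoped Classical

/-- The degree of a vertex `v` under an edge-weight assignment `x`:
the sum of the weights of the edges of `G` incident to `v`. -/
noncomputable def bmDeg {V : Type*} [Fintype V] (G : SimpleGraph V)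
    (x : Sym2 V → ℕ) (v : V) : ℕ :=
  ∑ e ∈ Finset.univ.filter (fun e : Sym2 V => e ∈ G.edgeSet ∧ v ∈ e), x e

/-- The cardinality `‖x‖₁` of an edge-weight assignment `x`. -/
noncomputable def bmCard {V : Type*} [Fintype V] (G : SimpleGraph V)
    (x : Sym2 V → ℕ) : ℕ :=
  ∑ e ∈ Finset.univ.filter (fun e : Sym2 V => e ∈ G.edgeSet), x e

/-- `x` is a `b`-matching of `(G, b)`: it is supported on the edges of `G`
and the degree of every vertex `v` is at most `b v`. -/
def IsBMatching {V : Type*} [Fintype V] (G : SimpleGraph V) (b : V → ℕ)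
    (x : Sym2 V → ℕ) : Prop :=
  (∀ e, e ∉ G.edgeSet → x e = 0) ∧ ∀ v, bmDeg G x v ≤ b v

/-- The maximum cardinality of a `b`-matching of `(G, b)`. -/
noncomputable def maxBM {V : Type*} [Fintype V] (G : SimpleGraph V) (b : V → ℕ) : ℕ :=
  sSup {m | ∃ x, IsBMatching G b x ∧ bmCard G x = m}

/-- `mu G b w t` : the maximum cardinality of a `b`-matching of `G` when the
capacity of `w` is set to `t` and every other vertex `v` has capacity `b v`. -/
noncomputable def mu {V : Type*} [Fintype V] (G : SimpleGraph V) (b : V → ℕ)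
    (w : V) (t : ℕ) : ℕ :=
  maxBM G (Function.update b w t)


/-- `(U, W)` is a split of `G`: a partition of the vertex set with both sides
of size at least `2`, such that every vertex of `U` having a neighbour in `W`
is adjacent to every vertex of `W` having a neighbour in `U`. -/
def IsSplit {V : Type*} (G : SimpleGraph V) (U W : Set V) : Prop :=
  U ∪ W = Set.univ ∧ Disjoint U W ∧ 2 ≤ U.ncard ∧ 2 ≤ W.ncard ∧
    ∀ a ∈ U, ∀ c ∈ W, (∃ b' ∈ W, G.Adj a b') → (∃ a' ∈ U, G.Adj a' c) → G.Adj a c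

/-- `splitC G U W` is the set of vertices of `U` with a neighbour in `W`
(so `splitC G U W = C = N_G(W)` and `splitC G W U = D = N_G(U)`). -/
def splitC {V : Type*} (G : SimpleGraph V) (U W : Set V) : Set V :=
  {a | a ∈ U ∧ ∃ c ∈ W, G.Adj a c}

/-- Given a split `(U, W)` (with `C = N_G(W)`), the graph `G_U` on `U ∪ {w}`:
the induced subgraph `G[U]` together with a new split marker vertex `w`
(represented by `none`) adjacent to every vertex of `C`. -/
def sideGraph {V : Type*} (G : SimpleGraph V) (U C : Set V) :
    SimpleGraph (Option ↥U) :=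
  SimpleGraph.fromRel (fun a c =>
    match a, c with
    | some a', some c' => G.Adj ↑a' ↑c'
    | some a', none => ↑a' ∈ C
    | _, _ => False)

theorem transport_aux {A B : Type*} [Fintype A] [Fintype B] (d : ℕ) :
    ∀ (r : A → ℕ) (c : B → ℕ), ∑ a, r a = d → ∑ b, c b = d →
    ∃ m : A → B → ℕ, (∀ a, ∑ b, m a b = r a) ∧ (∀ b, ∑ a, m a b = c b) := by
  induction d with
  | zero =>
    intro r c hr hc
    refine ⟨fun _ _ => 0, ?_, ?_⟩
    · intro a
      have := (Finset.sum_eq_zero_iff.mp hr) a (Finset.mem_univ a)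
      simp [this]
    · intro b
      have := (Finset.sum_eq_zero_iff.mp hc) b (Finset.mem_univ b)
      simp [this]
  | succ d ih =>
    intro r c hr hc
    obtain ⟨a0, -, ha0⟩ : ∃ a ∈ Finset.univ, r a ≠ 0 :=
      Finset.exists_ne_zero_of_sum_ne_zero (by omega)
    obtain ⟨b0, -, hb0⟩ : ∃ b ∈ Finset.univ, c b ≠ 0 :=
      Finset.exists_ne_zero_of_sum_ne_zero (by omega)
    have er : ∀ a, r a = (if a = a0 then r a - 1 else r a) + (if a = a0 then 1 else 0) := by
      intro a
      by_cases h : a = a0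
      · subst h; simp; omega
      · simp [h]
    have ec : ∀ b, c b = (if b = b0 then c b - 1 else c b) + (if b = b0 then 1 else 0) := by
      intro b
      by_cases h : b = b0
      · subst h; simp; omega
      · simp [h]
    obtain ⟨m, h1, h2⟩ := ih (fun a => if a = a0 then r a - 1 else r a)
      (fun b => if b = b0 then c b - 1 else c b)
      (by
        rw [Finset.sum_congr rfl (fun a _ => er a), Finset.sum_add_distrib] at hr
        simpa using hr)
      (by
        rw [Finset.sum_congr rfl (fun a _ => ec a), Finset.sum_add_distrib] at hc
        simpa using hc)
    refine ⟨fun a b => m a b + (if a = a0 then (if b = b0 then 1 else 0) else 0), ?_, ?_⟩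
    · intro a
      rw [Finset.sum_add_distrib, h1, er a]
      by_cases h : a = a0 <;> simp [h]
    · intro b
      rw [Finset.sum_add_distrib, h2, ec b]
      by_cases h : b = b0 <;> simp [h]

theorem bmDeg_eq_sum {V : Type*} [Fintype V] (G : SimpleGraph V) (x : Sym2 V → ℕ)
    (hx : ∀ e, e ∉ G.edgeSet → x e = 0) (v : V) : bmDeg G x v = ∑ u, x s(v, u) := by
  unfold bmDeg
  have : ∑ u, x s(v, u) = ∑ e ∈ Finset.univ.image (fun u => s(v, u)), x e := by
    rw [Finset.sum_image]
    intro a _ c _ h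
    exact Sym2.congr_right.mp h
  rw [this]
  apply Finset.sum_subset
  · intro e he
    simp only [Finset.mem_filter, Finset.mem_univ, true_and] at he
    obtain ⟨u, rfl⟩ := he.2
    simp
  · intro e he hne
    apply hx
    intro h
    apply hne
    simp only [Finset.mem_image, Finset.mem_univ, true_and] at he
    obtain ⟨u, rfl⟩ := he
    simp only [Finset.mem_filter, Finset.mem_univ, true_and]
    exact ⟨h, Sym2.mem_mk_left _ _⟩

theorem sum_bmDeg {V : Type*} [Fintype V] (G : SimpleGraph V) (x : Sym2 V → ℕ) :
    ∑ v, bmDeg G x v = 2 * bmCard G x := by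
  unfold bmDeg bmCard
  have h : ∀ v, ∑ e ∈ Finset.univ.filter (fun e : Sym2 V => e ∈ G.edgeSet ∧ v ∈ e), x e
      = ∑ e ∈ Finset.univ.filter (fun e : Sym2 V => e ∈ G.edgeSet), if v ∈ e then x e else 0 := by
    intro v
    rw [← Finset.sum_filter, Finset.filter_filter]
  rw [Finset.sum_congr rfl (fun v _ => h v), Finset.sum_comm, Finset.mul_sum]
  apply Finset.sum_congr rfl
  intro e he
  simp only [Finset.mem_filter, Finset.mem_univ, true_and] at he
  induction e using Sym2.ind with
  | _ a c =>
    have hne : a ≠ c := G.ne_of_adj (by simpa using he)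
    rw [← Finset.sum_filter, Finset.sum_const]
    have : (Finset.univ.filter (fun v => v ∈ s(a, c))) = {a, c} := by
      ext v; simp
    rw [this, Finset.card_pair hne, smul_eq_mul]

theorem sum_split {V : Type*} [Fintype V] (U W : Set V) (h1 : U ∪ W = Set.univ)
    (h2 : Disjoint U W) (g : V → ℕ) :
    ∑ v, g v = ∑ v : ↥U, g v + ∑ v : ↥W, g v := by
  have hW : ∀ v, v ∈ W ↔ ¬ v ∈ U := by
    intro v
    constructor
    · intro hw hu
      exact Set.disjoint_left.mp h2 hu hw
    · intro hu
      have : v ∈ U ∪ W := by rw [h1]; trivial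
      exact this.resolve_left hu
  rw [← Finset.sum_filter_add_sum_filter_not Finset.univ (fun v => v ∈ U) g]
  congr 1
  · exact Finset.sum_subtype _ (by simp) g
  · exact Finset.sum_subtype _ (by simp [hW]) g

theorem side_some {V : Type*} (G : SimpleGraph V) (U C : Set V) (a c : ↥U) :
    (sideGraph G U C).Adj (some a) (some c) ↔ G.Adj a c := by
  simp only [sideGraph, SimpleGraph.fromRel_adj]
  constructor
  · rintro ⟨_, h | h⟩
    · exact h
    · exact h.symm
  · intro h
    refine ⟨?_, Or.inl h⟩
    intro e
    simp only [Option.some.injEq] at e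
    exact G.ne_of_adj h (by rw [e])

theorem side_none {V : Type*} (G : SimpleGraph V) (U C : Set V) (a : ↥U) :
    (sideGraph G U C).Adj none (some a) ↔ ↑a ∈ C := by
  simp [sideGraph, SimpleGraph.fromRel_adj]

/-- Merging partial solutions along a split: if `(U, W)` is a split of `G`,
`b^U` and `b^W` are capacity functions with `b^U_v ≤ b v` on `U` and
`b^W_v ≤ b v` on `W` (arbitrary capacities at the split markers `w` and `u`,
represented by `none`), and `x^U`, `x^W` are `b`-matchings of `(G_U, b^U)` and
`(G_W, b^W)` with `deg_{x^U}(w) = deg_{x^W}(u) = d`, then there exists a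
`b`-matching `x` of `(G, b)` with `‖x‖₁ = ‖x^U‖₁ + ‖x^W‖₁ − d`. -/
theorem merge_bmatchings {V : Type*} [Fintype V] (G : SimpleGraph V)
    (hG : G.Connected) (b : V → ℕ) (U W : Set V) (hsplit : IsSplit G U W)
    (bU : Option ↥U → ℕ) (bW : Option ↥W → ℕ)
    (hbU : ∀ v : ↥U, bU (some v) ≤ b ↑v)
    (hbW : ∀ v : ↥W, bW (some v) ≤ b ↑v)
    (xU : Sym2 (Option ↥U) → ℕ) (xW : Sym2 (Option ↥W) → ℕ)
    (hxU : IsBMatching (sideGraph G U (splitC G U W)) bU xU)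
    (hxW : IsBMatching (sideGraph G W (splitC G W U)) bW xW)
    (d : ℕ)
    (hdU : bmDeg (sideGraph G U (splitC G U W)) xU none = d)
    (hdW : bmDeg (sideGraph G W (splitC G W U)) xW none = d) :
    ∃ x : Sym2 V → ℕ, IsBMatching G b x ∧
      bmCard G x + d =
        bmCard (sideGraph G U (splitC G U W)) xU +
          bmCard (sideGraph G W (splitC G W U)) xW := by
  obtain ⟨hUW, hdis, -, -, hsp⟩ := hsplit
  obtain ⟨sU, cU⟩ := hxU
  obtain ⟨sW, cW⟩ := hxW
  have nU : xU s(none, none) = 0 := sU _ (by simp)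
  have nW : xW s(none, none) = 0 := sW _ (by simp)
  have eU : ∀ a : ↥U, bmDeg (sideGraph G U (splitC G U W)) xU (some a) =
      xU s(none, some a) + ∑ c : ↥U, xU s(some a, some c) := by
    intro a
    rw [bmDeg_eq_sum _ _ sU, Fintype.sum_option, Sym2.eq_swap]
  have eW : ∀ a : ↥W, bmDeg (sideGraph G W (splitC G W U)) xW (some a) =
      xW s(none, some a) + ∑ c : ↥W, xW s(some a, some c) := by
    intro a
    rw [bmDeg_eq_sum _ _ sW, Fintype.sum_option, Sym2.eq_swap]
  have dU : ∑ a : ↥U, xU s(none, some a) = d := by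
    rw [← hdU, bmDeg_eq_sum _ _ sU, Fintype.sum_option, nU, zero_add]
  have dW : ∑ a : ↥W, xW s(none, some a) = d := by
    rw [← hdW, bmDeg_eq_sum _ _ sW, Fintype.sum_option, nW, zero_add]
  obtain ⟨m, m1, m2⟩ := transport_aux d (fun a : ↥U => xU s(none, some a))
    (fun a : ↥W => xW s(none, some a)) dU dW
  have hW : ∀ v, ¬ v ∈ U → v ∈ W := by
    intro v hu
    have : v ∈ U ∪ W := by rw [hUW]; trivial
    exact this.resolve_left hu
  have hWU : ∀ v, v ∈ W → ¬ v ∈ U := fun v hw hu => Set.disjoint_left.mp hdis hu hw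
  have mz : ∀ (a : ↥U) (c : ↥W), ¬ G.Adj a c → m a c = 0 := by
    intro a c h
    by_contra hm
    apply h
    have ha : (a : V) ∈ splitC G U W := by
      by_contra hn
      have h0 : xU s(none, some a) = 0 := sU _ (by
        rw [SimpleGraph.mem_edgeSet, side_none]; exact hn)
      have h3 := m1 a
      simp only [h0] at h3
      exact hm (Finset.sum_eq_zero_iff.mp h3 c (Finset.mem_univ c))
    have hc : (c : V) ∈ splitC G W U := by
      by_contra hn
      have h0 : xW s(none, some c) = 0 := sW _ (by
        rw [SimpleGraph.mem_edgeSet, side_none]; exact hn)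
      have h3 := m2 c
      simp only [h0] at h3
      exact hm (Finset.sum_eq_zero_iff.mp h3 a (Finset.mem_univ a))
    obtain ⟨u, hu, hcu⟩ := hc.2
    exact hsp a a.2 c c.2 ha.2 ⟨u, hu, hcu.symm⟩
  let f : V → V → ℕ := fun a c =>
    if ha : a ∈ U then
      if hc : c ∈ U then xU s(some ⟨a, ha⟩, some ⟨c, hc⟩) else m ⟨a, ha⟩ ⟨c, hW c hc⟩
    else
      if hc : c ∈ U then m ⟨c, hc⟩ ⟨a, hW a ha⟩
      else xW s(some ⟨a, hW a ha⟩, some ⟨c, hW c hc⟩)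
  have fs : ∀ a c, f a c = f c a := by
    intro a c
    by_cases ha : a ∈ U <;> by_cases hc : c ∈ U <;> simp only [f, ha, hc, dif_pos, dif_neg, not_false_eq_true]
    · rw [Sym2.eq_swap]
    · rw [Sym2.eq_swap]
  let x : Sym2 V → ℕ := Sym2.lift ⟨f, fs⟩
  have xf : ∀ a c, x s(a, c) = f a c := fun a c => rfl
  have sx : ∀ e, e ∉ G.edgeSet → x e = 0 := by
    intro e
    induction e using Sym2.ind with
    | _ a c =>
      intro h
      rw [SimpleGraph.mem_edgeSet] at h
      rw [xf]
      by_cases ha : a ∈ U <;> by_cases hc : c ∈ U <;> simp only [f, ha, hc, dif_pos, dif_neg, not_false_eq_true]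
      · exact sU _ (by rw [SimpleGraph.mem_edgeSet, side_some]; exact h)
      · exact mz _ _ h
      · exact mz _ _ (fun h' => h h'.symm)
      · exact sW _ (by rw [SimpleGraph.mem_edgeSet, side_some]; exact h)
  have degU : ∀ a : ↥U, bmDeg G x a = bmDeg (sideGraph G U (splitC G U W)) xU (some a) := by
    intro a
    rw [bmDeg_eq_sum _ _ sx, eU, sum_split U W hUW hdis, add_comm, ← m1 a]
    congr 1
    · apply Finset.sum_congr rfl
      intro c _
      simp [xf, f, hWU c c.2]
    · apply Finset.sum_congr rfl
      intro c _
      simp [xf, f]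
  have degW : ∀ a : ↥W, bmDeg G x a = bmDeg (sideGraph G W (splitC G W U)) xW (some a) := by
    intro a
    rw [bmDeg_eq_sum _ _ sx, eW, sum_split U W hUW hdis, ← m2 a]
    congr 1
    · apply Finset.sum_congr rfl
      intro c _
      simp [xf, f, hWU a a.2]
    · apply Finset.sum_congr rfl
      intro c _
      simp [xf, f, hWU a a.2, hWU c c.2]
  refine ⟨x, ⟨sx, ?_⟩, ?_⟩
  · intro v
    by_cases hv : v ∈ U
    · exact (degU ⟨v, hv⟩).trans_le ((cU _).trans (hbU _))
    · exact (degW ⟨v, hW v hv⟩).trans_le ((cW _).trans (hbW _))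
  · have t1 := sum_bmDeg G x
    have t2 := sum_bmDeg (sideGraph G U (splitC G U W)) xU
    have t3 := sum_bmDeg (sideGraph G W (splitC G W U)) xW
    rw [Fintype.sum_option, hdU] at t2
    rw [Fintype.sum_option, hdW] at t3
    rw [sum_split U W hUW hdis, Finset.sum_congr rfl (fun a _ => degU a),
      Finset.sum_congr rfl (fun a _ => degW a)] at t1
    omega
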